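/- Let G = (V = {1,…,n}, w) be a connected weighted graph. Then the fractional Cheeger constant of G is attained: there exists a fractional partition (ρ,η) of V with Σ_u ρ(u)·vol(u) > 0 and Σ_v η(v)·vol(v) > 0 such that h̃(G; ρ, η) = h̃_G. -/

import Mathlib

open Finset

noncomputable section

/-- A weighted graph on the vertex set `{1,…,n}` (modelled as `Fin n`):
a symmetric weight function with values in `[0,1]`. -/
structure WGraph (n : ℕ) where
  w : Fin n → Fin n → ℝ
  symm : ∀ u v, w u v = w v u
  nonneg : ∀ u v, 0 ≤ w u v
  le_one : ∀ u v, w u v ≤ 1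

namespace WGraph

variable {n : ℕ}

/-- The volume of a vertex: `vol(u) = Σ_v w(u,v)`. -/
def vol (Gr : WGraph n) (u : Fin n) : ℝ := ∑ v, Gr.w u v

/-- The total volume `vol(G) = Σ_u vol(u)`. -/
def volG (Gr : WGraph n) : ℝ := ∑ u, Gr.vol u

/-- The total weight of edges crossing the cut `(A, Aᶜ)`. -/
def cut (Gr : WGraph n) (A : Finset (Fin n)) : ℝ := ∑ u ∈ A, ∑ v ∈ Aᶜ, Gr.w u v

/-- Connectedness: every cut into two nonempty parts has positive weight. -/
def Connected (Gr : WGraph n) : Prop :=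
  ∀ A : Finset (Fin n), A.Nonempty → A ≠ Finset.univ → 0 < Gr.cut A

/-- Looplessness: `w(u,u) = 0` for all `u`. -/
def Loopless (Gr : WGraph n) : Prop := ∀ u, Gr.w u u = 0

/-- The Cheeger constant of a weighted graph. -/
def cheeger (Gr : WGraph n) : ℝ :=
  sInf {r : ℝ | ∃ A : Finset (Fin n), A.Nonempty ∧ A ≠ Finset.univ ∧
    r = Gr.cut A / min (∑ u ∈ A, Gr.vol u) (∑ v ∈ Aᶜ, Gr.vol v)}

/-- A fractional partition of the vertex set: `ρ : V → [0,1]` (with `η = 1 − ρ`). -/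
def IsFracPartition (ρ : Fin n → ℝ) : Prop := ∀ u, 0 ≤ ρ u ∧ ρ u ≤ 1

/-- The quantity `h̃(G; ρ, 1−ρ)` from the definition of the fractional Cheeger
constant. -/
def fracH (Gr : WGraph n) (ρ : Fin n → ℝ) : ℝ :=
  (∑ u, ∑ v, ρ u * (1 - ρ v) * Gr.w u v) /
    min (∑ u, ρ u * Gr.vol u) (∑ v, (1 - ρ v) * Gr.vol v)

/-- The fractional Cheeger constant: the infimum of `h̃(G; ρ, η)` over all fractional
partitions `(ρ, η = 1 − ρ)` with `Σ ρ(u)vol(u) > 0` and `Σ η(v)vol(v) > 0`. -/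
def fracCheeger (Gr : WGraph n) : ℝ :=
  sInf {r : ℝ | ∃ ρ : Fin n → ℝ, IsFracPartition ρ ∧
    0 < ∑ u, ρ u * Gr.vol u ∧ 0 < ∑ v, (1 - ρ v) * Gr.vol v ∧ r = Gr.fracH ρ}

end WGraph

namespace WGraph

variable {n : ℕ}

theorem vol_nonneg (Gr : WGraph n) (u : Fin n) : 0 ≤ Gr.vol u :=
  Finset.sum_nonneg fun v _ => Gr.nonneg u v

/-- In a connected weighted graph of positive total volume every vertex has positive volume. -/
theorem Connected.vol_pos {Gr : WGraph n} (hconn : Gr.Connected) (hvol : 0 < Gr.volG)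
    (u : Fin n) : 0 < Gr.vol u := by
  by_cases h : ({u} : Finset (Fin n)) = Finset.univ
  · rwa [volG, ← h, Finset.sum_singleton] at hvol
  · refine (hconn {u} (Finset.singleton_nonempty u) h).trans_le ?_
    rw [cut, Finset.sum_singleton]
    exact Finset.sum_le_sum_of_subset_of_nonneg (Finset.subset_univ _)
      fun v _ _ => Gr.nonneg u v

theorem sum_one_sub_mul_vol (Gr : WGraph n) (ρ : Fin n → ℝ) :
    ∑ v, (1 - ρ v) * Gr.vol v = Gr.volG - ∑ u, ρ u * Gr.vol u := by
  simp only [volG, sub_mul, one_mul, Finset.sum_sub_distrib]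

theorem fracH_one_sub (Gr : WGraph n) (ρ : Fin n → ℝ) :
    Gr.fracH (fun u => 1 - ρ u) = Gr.fracH ρ := by
  simp only [fracH, sub_sub_cancel]
  rw [min_comm, Finset.sum_comm]
  simp only [Gr.symm, mul_comm (1 - ρ _)]

/-- Fractional partitions both of whose sides have volume at least `c`. -/
def volBounded (Gr : WGraph n) (c : ℝ) : Set (Fin n → ℝ) :=
  {ρ | IsFracPartition ρ ∧ c ≤ ∑ u, ρ u * Gr.vol u ∧ c ≤ ∑ v, (1 - ρ v) * Gr.vol v}

theorem isCompact_volBounded (Gr : WGraph n) (c : ℝ) : IsCompact (Gr.volBounded c) := by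
  have hcube : IsCompact (Set.Icc (0 : Fin n → ℝ) 1) := isCompact_Icc
  refine hcube.of_isClosed_subset ?_ fun ρ hρ => ⟨fun u => (hρ.1 u).1, fun u => (hρ.1 u).2⟩
  have hfrac : IsClosed {ρ : Fin n → ℝ | IsFracPartition ρ} := by
    simp only [IsFracPartition, Set.ofPred_forall]
    exact isClosed_iInter fun u =>
      (isClosed_le continuous_const (continuous_apply u)).inter
        (isClosed_le (continuous_apply u) continuous_const)
  have hleft : IsClosed {ρ : Fin n → ℝ | c ≤ ∑ u, ρ u * Gr.vol u} :=
    isClosed_le continuous_const (by fun_prop)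
  have hright : IsClosed {ρ : Fin n → ℝ | c ≤ ∑ v, (1 - ρ v) * Gr.vol v} :=
    isClosed_le continuous_const (by fun_prop)
  exact hfrac.inter (hleft.inter hright)

theorem continuousOn_fracH (Gr : WGraph n) {c : ℝ} (hc : 0 < c) :
    ContinuousOn Gr.fracH (Gr.volBounded c) := by
  unfold fracH
  refine ContinuousOn.div (by fun_prop) (by fun_prop) fun ρ hρ => ?_
  exact (hc.trans_le (le_min hρ.2.1 hρ.2.2)).ne'

/-- Scaling up the side of smaller volume does not increase `fracH`. -/
theorem exists_mem_volBounded_fracH_le_of_le_half (Gr : WGraph n) {c : ℝ}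
    (hpos : ∀ u, 0 < Gr.vol u) (hcu : ∀ u, c ≤ Gr.vol u) (hcS : c ≤ Gr.volG / 2)
    {ρ : Fin n → ℝ} (hρ : IsFracPartition ρ) (hρpos : 0 < ∑ u, ρ u * Gr.vol u)
    (hhalf : ∑ u, ρ u * Gr.vol u ≤ Gr.volG / 2) :
    ∃ σ ∈ Gr.volBounded c, Gr.fracH σ ≤ Gr.fracH ρ := by
  set a := ∑ u, ρ u * Gr.vol u with ha
  rcases le_or_gt c a with hca | hac
  · exact ⟨ρ, ⟨hρ, hca, by rw [sum_one_sub_mul_vol]; linarith⟩, le_rfl⟩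
  set t := c / a with ht
  have ht1 : 1 ≤ t := (one_le_div hρpos).2 hac.le
  have ht0 : 0 < t := one_pos.trans_le ht1
  have hta : t * a = c := div_mul_cancel₀ c hρpos.ne'
  have hsum : ∑ u, t * ρ u * Gr.vol u = c := by
    simp only [mul_assoc, ← Finset.mul_sum]
    exact hta
  have hnn : ∀ u, 0 ≤ t * ρ u := fun u => mul_nonneg ht0.le (hρ u).1
  have hle : ∀ u, t * ρ u ≤ 1 := fun u => by
    have h : t * ρ u * Gr.vol u ≤ ∑ u, t * ρ u * Gr.vol u :=
      Finset.single_le_sum (f := fun u => t * ρ u * Gr.vol u)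
        (fun v _ => mul_nonneg (hnn v) (Gr.vol_nonneg v)) (Finset.mem_univ u)
    refine le_of_mul_le_mul_right ?_ (hpos u)
    linarith [hcu u]
  refine ⟨fun u => t * ρ u, ⟨fun u => ⟨hnn u, hle u⟩, hsum.ge, ?_⟩, ?_⟩
  · rw [sum_one_sub_mul_vol, hsum]
    linarith
  · rw [fracH, fracH, sum_one_sub_mul_vol, sum_one_sub_mul_vol, hsum, ← ha,
      min_eq_left (by linarith), min_eq_left (by linarith), ← hta,
      ← mul_div_mul_left _ a ht0.ne']
    refine div_le_div_of_nonneg_right ?_ (mul_pos ht0 hρpos).le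
    simp only [Finset.mul_sum]
    refine Finset.sum_le_sum fun u _ => Finset.sum_le_sum fun v _ => ?_
    have hv : 1 - t * ρ v ≤ 1 - ρ v := by
      linarith [le_mul_of_one_le_left (hρ v).1 ht1]
    calc t * ρ u * (1 - t * ρ v) * Gr.w u v
        ≤ t * ρ u * (1 - ρ v) * Gr.w u v :=
          mul_le_mul_of_nonneg_right (mul_le_mul_of_nonneg_left hv (hnn u)) (Gr.nonneg u v)
      _ = t * (ρ u * (1 - ρ v) * Gr.w u v) := by ring

theorem exists_mem_volBounded_fracH_le (Gr : WGraph n) {c : ℝ}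
    (hpos : ∀ u, 0 < Gr.vol u) (hcu : ∀ u, c ≤ Gr.vol u) (hcS : c ≤ Gr.volG / 2)
    {ρ : Fin n → ℝ} (hρ : IsFracPartition ρ) (h₁ : 0 < ∑ u, ρ u * Gr.vol u)
    (h₂ : 0 < ∑ v, (1 - ρ v) * Gr.vol v) :
    ∃ σ ∈ Gr.volBounded c, Gr.fracH σ ≤ Gr.fracH ρ := by
  rcases le_total (∑ u, ρ u * Gr.vol u) (Gr.volG / 2) with h | h
  · exact Gr.exists_mem_volBounded_fracH_le_of_le_half hpos hcu hcS hρ h₁ h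
  · rw [← Gr.fracH_one_sub ρ]
    refine Gr.exists_mem_volBounded_fracH_le_of_le_half hpos hcu hcS
      (fun u => ⟨sub_nonneg.2 (hρ u).2, sub_le_self _ (hρ u).1⟩) h₂ ?_
    rw [sum_one_sub_mul_vol]
    linarith

end WGraph

/-- **Realization of the fractional Cheeger constant.**
For a connected weighted graph (with positive total volume, so that fractional
partitions with positive volumes on both sides exist), the fractional Cheeger constant
is attained by some fractional partition. -/
theorem fracCheeger_attained {n : ℕ} (Gr : WGraph n) (hconn : Gr.Connected)
    (hvol : 0 < Gr.volG) :
    ∃ ρ : Fin n → ℝ, WGraph.IsFracPartition ρ ∧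
      0 < ∑ u, ρ u * Gr.vol u ∧ 0 < ∑ v, (1 - ρ v) * Gr.vol v ∧
      Gr.fracH ρ = Gr.fracCheeger := by
  have hpos := hconn.vol_pos hvol
  obtain ⟨c, hc, hcu, hcS⟩ : ∃ c : ℝ, 0 < c ∧ (∀ u, c ≤ Gr.vol u) ∧ c ≤ Gr.volG / 2 := by
    have hne : (Finset.univ : Finset (Fin n)).Nonempty :=
      Finset.nonempty_of_sum_ne_zero hvol.ne'
    obtain ⟨m, -, hm⟩ := Finset.exists_min_image Finset.univ Gr.vol hne
    exact ⟨min (Gr.vol m) (Gr.volG / 2), lt_min (hpos m) (half_pos hvol),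
      fun u => (min_le_left _ _).trans (hm u (Finset.mem_univ u)), min_le_right _ _⟩
  have hhalf : (fun _ => 1 / 2 : Fin n → ℝ) ∈ Gr.volBounded c := by
    have hsum : ∑ u, (1 / 2 : ℝ) * Gr.vol u = Gr.volG / 2 := by
      rw [← Finset.mul_sum, WGraph.volG]
      ring
    refine ⟨fun u => by norm_num, hsum ▸ hcS, ?_⟩
    rw [WGraph.sum_one_sub_mul_vol, hsum]
    linarith
  obtain ⟨ρ, hρ, hmin⟩ :=
    (Gr.isCompact_volBounded c).exists_isMinOn ⟨_, hhalf⟩ (Gr.continuousOn_fracH hc)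
  have h₁ := hc.trans_le hρ.2.1
  have h₂ := hc.trans_le hρ.2.2
  refine ⟨ρ, hρ.1, h₁, h₂, Eq.symm ?_⟩
  refine IsLeast.csInf_eq ⟨⟨ρ, hρ.1, h₁, h₂, rfl⟩, ?_⟩
  rintro _ ⟨τ, hτ, hτ₁, hτ₂, rfl⟩
  obtain ⟨σ, hσ, hle⟩ := Gr.exists_mem_volBounded_fracH_le hpos hcu hcS hτ hτ₁ hτ₂
  exact (hmin hσ).trans hle
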